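/- Fix a ∈ ℂ∖{0}, λ ∈ ℝ∖{0}, and let (h,k) : Δ → ℂⁿ×ℂⁿ be C¹. Then ℋ(h,k) = 0 and 𝒦(h,k) = 0 hold identically on Δ if and only if: the components h^α (1 ≤ α ≤ n−1) and kₙ are holomorphic on Δ, and the functions hⁿ + (i·conj(a)/2)·Σ_α A_{1̄ᾱ}·conj(h^α)·ζ̄ − i·conj(a)·Σ_α A_{1̄ᾱ}·conj(ℐ(h^α)) and k_α + (i·a/2)·conj(A_{ᾱ1̄})·ζ·conj(kₙ) + (i·λ/2)·Σ_β conj(A_{ᾱβ̄})·h^β·ζ̄ (for each 1 ≤ α ≤ n−1) are holomorphic on Δ. -/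

import Mathlib

open Complex ComplexConjugate Finset

noncomputable section

/-- Wirtinger derivative `∂F/∂ζ` of a scalar function. -/
def wderC (F : ℂ → ℂ) (ζ : ℂ) : ℂ :=
  (2⁻¹ : ℂ) * (fderiv ℝ F ζ 1 - Complex.I * fderiv ℝ F ζ Complex.I)

/-- Wirtinger derivative `∂F/∂ζ̄` of a scalar function. -/
def wbarC (F : ℂ → ℂ) (ζ : ℂ) : ℂ :=
  (2⁻¹ : ℂ) * (fderiv ℝ F ζ 1 + Complex.I * fderiv ℝ F ζ Complex.I)

/-- `F` is real differentiable at `ζ`, with Wirtinger derivative `∂F/∂ζ̄ = w` there. -/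
def HasWbarAt (F : ℂ → ℂ) (w ζ : ℂ) : Prop :=
  DifferentiableAt ℝ F ζ ∧ wbarC F ζ = w

namespace HasWbarAt

variable {F G : ℂ → ℂ} {v w ζ : ℂ}

theorem of_hasFDerivAt {L : ℂ →L[ℝ] ℂ} (hF : HasFDerivAt F L ζ)
    (hw : 2⁻¹ * (L 1 + I * L I) = w) : HasWbarAt F w ζ :=
  ⟨hF.differentiableAt, by rw [wbarC, hF.fderiv, hw]⟩

theorem of_differentiableAt_real (hF : DifferentiableAt ℝ F ζ) : HasWbarAt F (wbarC F ζ) ζ :=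
  ⟨hF, rfl⟩

/-- The Cauchy–Riemann equation in Wirtinger form. -/
theorem differentiableAt_iff (hF : HasWbarAt F w ζ) : DifferentiableAt ℂ F ζ ↔ w = 0 := by
  obtain ⟨hd, rfl⟩ := hF
  rw [differentiableAt_complex_iff_differentiableAt_real, wbarC, smul_eq_mul]
  refine ⟨fun h => ?_, fun h => ⟨hd, ?_⟩⟩
  · rw [h.2, ← mul_assoc, I_mul_I]
    ring
  · linear_combination (-2 * I) * h + fderiv ℝ F ζ I * I_mul_I

theorem of_differentiableAt (hF : DifferentiableAt ℂ F ζ) : HasWbarAt F 0 ζ := by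
  have h := of_differentiableAt_real (hF.restrictScalars ℝ)
  rwa [h.differentiableAt_iff.1 hF] at h

theorem const (c : ℂ) : HasWbarAt (fun _ => c) 0 ζ :=
  of_differentiableAt (differentiableAt_const c)

theorem add (hF : HasWbarAt F v ζ) (hG : HasWbarAt G w ζ) :
    HasWbarAt (fun z => F z + G z) (v + w) ζ := by
  obtain ⟨hF, rfl⟩ := hF
  obtain ⟨hG, rfl⟩ := hG
  refine of_hasFDerivAt (hF.hasFDerivAt.add hG.hasFDerivAt) ?_
  simp only [add_apply, wbarC]
  ring

theorem sub (hF : HasWbarAt F v ζ) (hG : HasWbarAt G w ζ) :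
    HasWbarAt (fun z => F z - G z) (v - w) ζ := by
  obtain ⟨hF, rfl⟩ := hF
  obtain ⟨hG, rfl⟩ := hG
  refine of_hasFDerivAt (hF.hasFDerivAt.sub hG.hasFDerivAt) ?_
  simp only [sub_apply, wbarC]
  ring

theorem mul (hF : HasWbarAt F v ζ) (hG : HasWbarAt G w ζ) :
    HasWbarAt (fun z => F z * G z) (F ζ * w + v * G ζ) ζ := by
  obtain ⟨hF, rfl⟩ := hF
  obtain ⟨hG, rfl⟩ := hG
  refine of_hasFDerivAt (hF.hasFDerivAt.mul hG.hasFDerivAt) ?_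
  simp only [add_apply, smul_apply, smul_eq_mul, wbarC]
  ring

theorem const_mul (c : ℂ) (hF : HasWbarAt F w ζ) : HasWbarAt (fun z => c * F z) (c * w) ζ := by
  simpa using (const c).mul hF

theorem sum {ι : Type*} {s : Finset ι} {F : ι → ℂ → ℂ} {w : ι → ℂ}
    (hF : ∀ i ∈ s, HasWbarAt (F i) (w i) ζ) :
    HasWbarAt (fun z => ∑ i ∈ s, F i z) (∑ i ∈ s, w i) ζ := by
  refine of_hasFDerivAt (HasFDerivAt.fun_sum fun i hi => (hF i hi).1.hasFDerivAt) ?_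
  simp only [_root_.sum_apply, mul_sum, ← sum_add_distrib]
  refine sum_congr rfl fun i hi => ?_
  rw [← (hF i hi).2, wbarC]

theorem conj_comp (hF : DifferentiableAt ℝ F ζ) :
    HasWbarAt (fun z => conj (F z)) (conj (wderC F ζ)) ζ := by
  refine of_hasFDerivAt
    ((conjCLE : ℂ →L[ℝ] ℂ).hasFDerivAt.comp ζ hF.hasFDerivAt) ?_
  simp [wderC, Complex.conj_ofNat]

end HasWbarAt

theorem wderC_eq_of_hasDerivAt {F : ℂ → ℂ} {F' ζ : ℂ} (hF : HasDerivAt F F' ζ) :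
    wderC F ζ = F' := by
  rw [wderC, (hF.hasFDerivAt.restrictScalars ℝ).fderiv]
  simp only [ContinuousLinearMap.coe_restrictScalars', ContinuousLinearMap.toSpanSingleton_apply,
    smul_eq_mul]
  linear_combination (-2⁻¹ * F') * I_mul_I

theorem hasWbarAt_conj (ζ : ℂ) : HasWbarAt (fun z => conj z) 1 ζ := by
  simpa [wderC_eq_of_hasDerivAt (hasDerivAt_id' ζ)] using
    HasWbarAt.conj_comp (F := fun z => z) (ζ := ζ) differentiableAt_id

/-- On a disc centred at the origin, a family of holomorphic functions has primitives vanishing at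
the origin. -/
theorem exists_primitives {ι : Type*} {f : ι → ℂ → ℂ} {r : ℝ}
    (hf : ∀ i, DifferentiableOn ℂ (f i) (Metric.ball (0 : ℂ) r)) :
    ∃ P : ι → ℂ → ℂ, ∀ i, DifferentiableOn ℂ (P i) (Metric.ball (0 : ℂ) r) ∧ P i 0 = 0 ∧
      ∀ ζ ∈ Metric.ball (0 : ℂ) r, HasDerivAt (P i) (f i ζ) ζ := by
  choose P hP using fun i => (hf i).isExactOn_ball.with_val_at 0 0
  exact ⟨P, fun i => ⟨fun ζ hζ => ((hP i).2 ζ hζ).differentiableAt.differentiableWithinAt,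
    (hP i).1, (hP i).2⟩⟩

theorem hasWbarAt_horizontal_combination {ι : Type*} [Fintype ι] {c : ι → ℂ} {b ζ : ℂ}
    {g : ℂ → ℂ} {f P : ι → ℂ → ℂ} (hg : DifferentiableAt ℝ g ζ)
    (hf : ∀ i, DifferentiableAt ℝ (f i) ζ) (hP : ∀ i, HasDerivAt (P i) (f i ζ) ζ) :
    HasWbarAt
      (fun z => g z + (I * b / 2) * (∑ i, c i * conj (f i z)) * conj z -
        I * b * ∑ i, c i * conj (P i z))
      (wbarC g ζ - (I * b / 2) * (∑ i, c i * conj (f i ζ)) +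
        (I * b / 2) * (∑ i, c i * conj (wderC (f i) ζ)) * conj ζ) ζ := by
  have hS := HasWbarAt.sum (s := univ) fun i _ => (HasWbarAt.conj_comp (hf i)).const_mul (c i)
  have hT := HasWbarAt.sum (s := univ) fun i _ =>
    (HasWbarAt.conj_comp ((hP i).differentiableAt.restrictScalars ℝ)).const_mul (c i)
  simp only [wderC_eq_of_hasDerivAt (hP _)] at hT
  convert ((HasWbarAt.of_differentiableAt_real hg).add
    ((hS.const_mul (I * b / 2)).mul (hasWbarAt_conj ζ))).sub (hT.const_mul (I * b)) using 1
  ring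

theorem hasWbarAt_vertical_combination {ι : Type*} [Fintype ι] {c : ι → ℂ} {b d ζ : ℂ}
    {g q : ℂ → ℂ} {f : ι → ℂ → ℂ} (hg : DifferentiableAt ℝ g ζ) (hq : DifferentiableAt ℝ q ζ)
    (hf : ∀ i, DifferentiableAt ℂ (f i) ζ) :
    HasWbarAt
      (fun z => g z + b * z * conj (q z) + d * (∑ i, c i * f i z) * conj z)
      (wbarC g ζ + b * ζ * conj (wderC q ζ) + d * ∑ i, c i * f i ζ) ζ := by
  have hS := HasWbarAt.of_differentiableAt
    (F := fun z => d * ∑ i, c i * f i z) (ζ := ζ) (by fun_prop)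
  have hB := HasWbarAt.of_differentiableAt (F := fun z => b * z) (ζ := ζ) (by fun_prop)
  convert ((HasWbarAt.of_differentiableAt_real hg).add (hB.mul (HasWbarAt.conj_comp hq))).add
    (hS.mul (hasWbarAt_conj ζ)) using 1
  ring

/-- characterization of the kernel of the linearized interior operators
`ℋ`, `𝒦` at the disc `f̂_{a,λ}`: the components `h^α`, `kₙ` are holomorphic and the
explicit combinations involving the primitives `ℐ(h^α)` are holomorphic. -/
theorem stmt17 (n : ℕ) [NeZero n] (A : Fin n → Fin n → ℂ)
    (hA : ∀ α β, A α β = - A β α)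
    (a : ℂ) (ha : a ≠ 0) (lam : ℝ) (hlam : lam ≠ 0)
    (h k : ℂ → Fin (n+1) → ℂ)
    (hh : ContDiffOn ℝ 1 h (Metric.ball (0:ℂ) 1))
    (hk : ContDiffOn ℝ 1 k (Metric.ball (0:ℂ) 1)) :
    (∀ ζ ∈ Metric.ball (0:ℂ) 1,
      -- ℋ^α(h,k) = 0
      (∀ α : Fin n, wbarC (fun ζ' => h ζ' α.castSucc) ζ = 0) ∧
      -- ℋⁿ(h,k) = 0
      (wbarC (fun ζ' => h ζ' (Fin.last n)) ζ -
        (Complex.I * conj a / 2) * (∑ α : Fin n, A 0 α * conj (h ζ α.castSucc)) +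
        (Complex.I * conj a / 2) *
          (∑ α : Fin n, A 0 α * conj (wderC (fun ζ' => h ζ' α.castSucc) ζ)) *
          conj ζ = 0) ∧
      -- 𝒦^α(h,k) = 0
      (∀ α : Fin n,
        wbarC (fun ζ' => k ζ' α.castSucc) ζ +
          (Complex.I * a / 2) * conj (A α 0) * ζ *
            conj (wderC (fun ζ' => k ζ' (Fin.last n)) ζ) +
          (Complex.I * lam / 2) * ∑ β : Fin n, conj (A α β) * h ζ β.castSucc = 0) ∧
      -- 𝒦ⁿ(h,k) = 0
      wbarC (fun ζ' => k ζ' (Fin.last n)) ζ = 0) ↔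
    ((∀ α : Fin n,
        DifferentiableOn ℂ (fun ζ => h ζ α.castSucc) (Metric.ball (0:ℂ) 1)) ∧
      DifferentiableOn ℂ (fun ζ => k ζ (Fin.last n)) (Metric.ball (0:ℂ) 1) ∧
      -- for the primitives ℐ(h^α) (holomorphic, vanishing at 0, with derivative h^α):
      (∀ Hp : Fin n → ℂ → ℂ,
        (∀ α : Fin n, DifferentiableOn ℂ (Hp α) (Metric.ball (0:ℂ) 1) ∧
          Hp α 0 = 0 ∧
          ∀ ζ ∈ Metric.ball (0:ℂ) 1, HasDerivAt (Hp α) (h ζ α.castSucc) ζ) →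
        (DifferentiableOn ℂ (fun ζ =>
            h ζ (Fin.last n) +
              (Complex.I * conj a / 2) *
                (∑ α : Fin n, A 0 α * conj (h ζ α.castSucc)) * conj ζ -
              Complex.I * conj a * ∑ α : Fin n, A 0 α * conj (Hp α ζ))
          (Metric.ball (0:ℂ) 1) ∧
        ∀ α : Fin n,
          DifferentiableOn ℂ (fun ζ =>
              k ζ α.castSucc +
                (Complex.I * a / 2) * conj (A α 0) * ζ * conj (k ζ (Fin.last n)) +
                (Complex.I * lam / 2) *
                  (∑ β : Fin n, conj (A α β) * h ζ β.castSucc) * conj ζ)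
            (Metric.ball (0:ℂ) 1)))) := by
  have hdiff : ∀ {F : ℂ → Fin (n + 1) → ℂ}, ContDiffOn ℝ 1 F (Metric.ball (0 : ℂ) 1) →
      ∀ ζ ∈ Metric.ball (0 : ℂ) 1, ∀ i, DifferentiableAt ℝ (fun z => F z i) ζ :=
    fun hF ζ hζ => differentiableAt_pi.1 <|
      (hF.differentiableOn one_ne_zero).differentiableAt (Metric.isOpen_ball.mem_nhds hζ)
  have hol_iff : ∀ {F : ℂ → ℂ} {w : ℂ → ℂ},
      (∀ ζ ∈ Metric.ball (0 : ℂ) 1, HasWbarAt F (w ζ) ζ) →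
      (DifferentiableOn ℂ F (Metric.ball (0 : ℂ) 1) ↔
        ∀ ζ ∈ Metric.ball (0 : ℂ) 1, w ζ = 0) := fun hF =>
    ⟨fun h ζ hζ => (hF ζ hζ).differentiableAt_iff.1
      (h.differentiableAt (Metric.isOpen_ball.mem_nhds hζ)),
    fun h ζ hζ => ((hF ζ hζ).differentiableAt_iff.2 (h ζ hζ)).differentiableWithinAt⟩
  have hol_h := fun i => hol_iff fun ζ hζ => .of_differentiableAt_real (hdiff hh ζ hζ i)
  have hol_k := fun i => hol_iff fun ζ hζ => .of_differentiableAt_real (hdiff hk ζ hζ i)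
  have hol_vert := fun (hα : ∀ α : Fin n,
      DifferentiableOn ℂ (fun ζ => h ζ α.castSucc) (Metric.ball (0 : ℂ) 1)) (α : Fin n) =>
    hol_iff fun ζ hζ => hasWbarAt_vertical_combination (c := fun β => conj (A α β))
      (b := (I * a / 2) * conj (A α 0)) (d := I * lam / 2)
      (hdiff hk ζ hζ α.castSucc) (hdiff hk ζ hζ (Fin.last n))
      fun β => (hα β).differentiableAt (Metric.isOpen_ball.mem_nhds hζ)
  constructor
  · intro H
    have hα := fun α : Fin n => (hol_h α.castSucc).2 fun ζ hζ => (H ζ hζ).1 α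
    refine ⟨hα, (hol_k (Fin.last n)).2 fun ζ hζ => (H ζ hζ).2.2.2, fun Hp hHp => ⟨?_, fun α => ?_⟩⟩
    · exact (hol_iff fun ζ hζ => hasWbarAt_horizontal_combination (hdiff hh ζ hζ (Fin.last n))
        (fun α => hdiff hh ζ hζ α.castSucc) fun α => (hHp α).2.2 ζ hζ).2 fun ζ hζ => (H ζ hζ).2.1
    · exact (hol_vert hα α).2 fun ζ hζ => (H ζ hζ).2.2.1 α
  · rintro ⟨hα, hn, H⟩ ζ hζ
    obtain ⟨Hp, hHp⟩ := exists_primitives hα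
    obtain ⟨H₁, H₂⟩ := H Hp hHp
    refine ⟨fun α => (hol_h α.castSucc).1 (hα α) ζ hζ, ?_,
      fun α => (hol_vert hα α).1 (H₂ α) ζ hζ, (hol_k (Fin.last n)).1 hn ζ hζ⟩
    exact (hol_iff fun ζ hζ => hasWbarAt_horizontal_combination (hdiff hh ζ hζ (Fin.last n))
      (fun α => hdiff hh ζ hζ α.castSucc) fun α => (hHp α).2.2 ζ hζ).1 H₁ ζ hζ
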